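/- For every L ≥ 1 there exist constants 0 < β ≤ 1 and C > 0, depending only on L, with the following property. Let Ω ⊊ ℂ be a simply connected domain and let α be an L-John curve in Ω with tip z ∈ Ω. Then for every x ∈ α, ρ_Ω(x,z) ≤ (1/β)·log(δ_Ω(x)/δ_Ω(z)) + C. -/

import Mathlib

open Set Metric Filter Bornology Complex Function

noncomputable section

/-- The upper half-plane as a subset of `ℂ`. -/
def UHP : Set ℂ := {z : ℂ | 0 < z.im}

/-- `K` is a half-plane hull: a bounded subset of the upper half-plane whose
complement in the upper half-plane is a simply connected domain. -/
def IsHull (K : Set ℂ) : Prop :=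
  IsBounded K ∧ K ⊆ UHP ∧ IsOpen (UHP \ K) ∧ IsConnected (UHP \ K) ∧
    SimplyConnectedSpace ↥(UHP \ K)

/-- `f` is the hydrodynamic conformal map of the hull `K`: a conformal bijection
from the upper half-plane onto `UHP \ K` with `f z - z → 0` as `|z| → ∞` in `UHP`. -/
def IsHydroMap (K : Set ℂ) (f : ℂ → ℂ) : Prop :=
  DifferentiableOn ℂ f UHP ∧ InjOn f UHP ∧ f '' UHP = UHP \ K ∧
    Tendsto (fun z => f z - z) (cobounded ℂ ⊓ 𝓟 UHP) (nhds (0 : ℂ))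

/-- `f` is the hydrodynamic map of `K` and `g` is its inverse. -/
def IsHydroPair (K : Set ℂ) (f g : ℂ → ℂ) : Prop :=
  IsHydroMap K f ∧ InvOn g f UHP (UHP \ K)

/-- `K` has half-plane capacity `a`, computed via its hydrodynamic map `f`:
`z * (z - f z) → a` as `|z| → ∞` in `UHP`. -/
def HasHcap (K : Set ℂ) (f : ℂ → ℂ) (a : ℝ) : Prop :=
  Tendsto (fun z => z * (z - f z)) (cobounded ℂ ⊓ 𝓟 UHP) (nhds (a : ℂ))

/-- The `(β, C₀)`-Hölder condition for a map defined on the upper half-plane. -/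
def IsHolder (f : ℂ → ℂ) (β C₀ : ℝ) : Prop :=
  ∀ z ∈ UHP, ∀ z' ∈ UHP, dist (f z) (f z') ≤ C₀ * max (dist z z' ^ β) (dist z z')

/-- The Poincaré hyperbolic distance on the upper half-plane. -/
def rhoH (z w : ℂ) : ℝ :=
  2 * Real.arsinh (dist z w / (2 * Real.sqrt (z.im * w.im)))

/-- The hyperbolic distance on a simply connected domain `Ω`, transported through a
conformal bijection `φ : UHP → Ω` (independent of the choice of `φ`). -/
def rhoVia (φ : ℂ → ℂ) (z w : ℂ) : ℝ :=
  rhoH (invFunOn φ UHP z) (invFunOn φ UHP w)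

/-- `log⁺ x = max (log x) 0`. -/
def posLog (x : ℝ) : ℝ := max (Real.log x) 0

/-- Internal distance between `A` and `B` inside `Ω`: the infimum of diameters of
connected subsets of `Ω` meeting both `A` and `B`. -/
def distIn (Ω A B : Set ℂ) : ℝ :=
  sInf {d : ℝ | ∃ E : Set ℂ, E ⊆ Ω ∧ IsConnected E ∧ (E ∩ A).Nonempty ∧
    (E ∩ B).Nonempty ∧ d = Metric.diam E}

/-- Internal diameter of `A` inside `Ω`. -/
def diamIn (Ω A : Set ℂ) : ℝ :=
  sSup {d : ℝ | ∃ a ∈ A, ∃ b ∈ A, d = distIn Ω {a} {b}}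

/-- An `L`-John curve in `Ω` with tip `z`, parametrized on `[0,1)` (the base-point,
which is not required to lie in `Ω`, corresponds to the missing endpoint). -/
def IsJohnCurve (Ω : Set ℂ) (L : ℝ) (α : ℝ → ℂ) (z : ℂ) : Prop :=
  ContinuousOn α (Ico 0 1) ∧ InjOn α (Ico 0 1) ∧ α 0 = z ∧
    MapsTo α (Ico 0 1) Ω ∧
    ∀ t ∈ Ico (0:ℝ) 1, Metric.diam (α '' Icc 0 t) ≤ L * infDist (α t) (frontier Ω)

/-- An `L`-John curve in `Ω` with tip `z` and base-point `∞`, parametrized on `[0,∞)`. -/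
def IsJohnCurveInfty (Ω : Set ℂ) (L : ℝ) (α : ℝ → ℂ) (z : ℂ) : Prop :=
  ContinuousOn α (Ici 0) ∧ InjOn α (Ici 0) ∧ α 0 = z ∧
    MapsTo α (Ici 0) Ω ∧ Tendsto α atTop (cobounded ℂ) ∧
    ∀ t ∈ Ici (0:ℝ), Metric.diam (α '' Icc 0 t) ≤ L * infDist (α t) (frontier Ω)

lemma isOpen_UHP' : IsOpen UHP := isOpen_lt continuous_const Complex.continuous_im

lemma not_eventually_const {φ : ℂ → ℂ} (hi : InjOn φ UHP) {a : ℂ} (ha : a ∈ UHP) :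
    ¬ ∀ᶠ z in nhds a, φ z = φ a := by
  intro h
  have h1 : ∀ᶠ z in nhds a, z = a := by
    filter_upwards [h, isOpen_UHP'.mem_nhds ha] with z hz hz'
    exact hi hz' ha hz
  have h2 : ∀ᶠ z in nhdsWithin a {a}ᶜ, False := by
    filter_upwards [h1.filter_mono nhdsWithin_le_nhds, self_mem_nhdsWithin] with z hz hz'
    exact hz' hz
  exact (h2.exists).elim fun _ h => h

lemma inv_continuousAt {φ g : ℂ → ℂ} (hd : DifferentiableOn ℂ φ UHP) (hi : InjOn φ UHP)
    (hg : ∀ a ∈ UHP, g (φ a) = a) {a : ℂ} (ha : a ∈ UHP) :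
    ContinuousAt g (φ a) ∧ UHP ∈ nhds a ∧ φ '' UHP ∈ nhds (φ a) := by
  have hn := isOpen_UHP'.mem_nhds ha
  have han : AnalyticAt ℂ φ a := hd.analyticAt hn
  have hle := han.eventually_constant_or_nhds_le_map_nhds.resolve_left (not_eventually_const hi ha)
  refine ⟨?_, hn, hle (image_mem_map hn)⟩
  intro U hU
  rw [hg a ha] at hU
  have : φ '' (U ∩ UHP) ∈ nhds (φ a) := hle (image_mem_map (Filter.inter_mem hU hn))
  rw [Filter.mem_map]
  refine Filter.mem_of_superset this ?_
  rintro _ ⟨w, ⟨hw, hw'⟩, rfl⟩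
  simpa [hg w hw'] using hw

lemma inv_differentiableAt_aux {φ g : ℂ → ℂ} (hd : DifferentiableOn ℂ φ UHP) (hi : InjOn φ UHP)
    (hg : ∀ a ∈ UHP, g (φ a) = a) {a : ℂ} (ha : a ∈ UHP) (h0 : deriv φ a ≠ 0) :
    DifferentiableAt ℂ g (φ a) := by
  obtain ⟨hc, hn, hn'⟩ := inv_continuousAt hd hi hg ha
  have hD : HasDerivAt φ (deriv φ a) (g (φ a)) := by
    rw [hg a ha]; exact (hd.differentiableAt hn).hasDerivAt
  refine (HasDerivAt.of_local_left_inverse hc hD h0 ?_).differentiableAt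
  filter_upwards [hn']
  rintro _ ⟨w, hw, rfl⟩
  rw [hg w hw]

lemma inv_differentiableAt {φ g : ℂ → ℂ} (hd : DifferentiableOn ℂ φ UHP) (hi : InjOn φ UHP)
    (hg : ∀ a ∈ UHP, g (φ a) = a) {a : ℂ} (ha : a ∈ UHP) :
    DifferentiableAt ℂ g (φ a) := by
  obtain ⟨hc, hn, hn'⟩ := inv_continuousAt hd hi hg ha
  have han : AnalyticAt ℂ φ a := hd.analyticAt hn
  rcases han.deriv.eventually_eq_zero_or_eventually_ne_zero with h | h
  · exfalso
    obtain ⟨r, hr, hb⟩ := Metric.mem_nhds_iff.1 (Filter.inter_mem h hn)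
    refine not_eventually_const hi ha ?_
    filter_upwards [Metric.ball_mem_nhds a hr] with w hw
    exact Metric.isOpen_ball.is_const_of_deriv_eq_zero (convex_ball a r).isPreconnected
      (hd.mono fun x hx => (hb hx).2) (fun x hx => (hb hx).1) hw (Metric.mem_ball_self hr)
  · apply AnalyticAt.differentiableAt
    apply Complex.analyticAt_of_differentiable_on_punctured_nhds_of_continuousAt _ hc
    have ht : Tendsto g (nhdsWithin (φ a) {φ a}ᶜ) (nhdsWithin a {a}ᶜ) := by
      apply tendsto_nhdsWithin_of_tendsto_nhds_of_eventually_within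
      · have := hc.tendsto
        rw [hg a ha] at this
        exact this.mono_left nhdsWithin_le_nhds
      · filter_upwards [nhdsWithin_le_nhds hn', self_mem_nhdsWithin]
        rintro _ ⟨w, hw, rfl⟩ hne
        rw [hg w hw]
        rintro rfl
        exact hne rfl
    filter_upwards [nhdsWithin_le_nhds hn', ht.eventually h]
    rintro _ ⟨w, hw, rfl⟩ hne
    rw [hg w hw] at hne
    exact inv_differentiableAt_aux hd hi hg hw hne

lemma rhoH_eq {a b : ℂ} (ha : a ∈ UHP) (hb : b ∈ UHP) :
    rhoH a b = dist (⟨a, ha⟩ : UpperHalfPlane) ⟨b, hb⟩ := by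
  rw [UpperHalfPlane.dist_eq]; rfl

lemma half_lt_tanh {y : ℝ} (hy : 1 ≤ y) : (1:ℝ)/2 < Real.tanh y := by
  have h2 : (2:ℝ) < Real.exp y := by
    have := Real.exp_one_gt_d9
    have := Real.exp_le_exp.2 hy
    linarith
  have h3 : Real.exp (-y) < 1/2 := by
    rw [Real.exp_neg, ← one_div]
    exact one_div_lt_one_div_of_lt (by norm_num) h2
  have h4 := Real.exp_pos (-y)
  rw [Real.tanh_eq_sinh_div_cosh, Real.sinh_eq, Real.cosh_eq, lt_div_iff₀ (by linarith)]
  linarith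

/-- Schwarz lemma for maps from a disc to the upper half-plane. -/
lemma schwarz_UHP {g : ℂ → ℂ} {p q : ℂ} {R : ℝ} (hd : DifferentiableOn ℂ g (ball p R))
    (hm : MapsTo g (ball p R) UHP) (hR : 0 < R) (hq : dist q p ≤ R / 2) :
    rhoH (g q) (g p) < 2 := by
  have hpB : p ∈ ball p R := mem_ball_self hR
  have hqB : q ∈ ball p R := by rw [mem_ball]; linarith
  have hp : 0 < (g p).im := hm hpB
  have key : ∀ w : ℂ, 0 < w.im → ‖w - g p‖ ≤ ‖w - (starRingEnd ℂ) (g p)‖ ∧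
      0 < ‖w - (starRingEnd ℂ) (g p)‖ := by
    intro w hw
    constructor
    · rw [← sq_le_sq₀ (norm_nonneg _) (norm_nonneg _), ← Complex.normSq_eq_norm_sq,
        ← Complex.normSq_eq_norm_sq, Complex.normSq_apply, Complex.normSq_apply]
      simp
      nlinarith [mul_pos hw hp]
    · rw [norm_pos_iff]
      intro h
      have := congrArg Complex.im h
      simp at this
      linarith
  let f : ℂ → ℂ := fun w => (g w - g p) / (g w - (starRingEnd ℂ) (g p))
  have hf : DifferentiableOn ℂ f (ball p R) := by
    apply DifferentiableOn.div (hd.sub_const _) (hd.sub_const _)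
    intro x hx
    exact norm_pos_iff.1 (key _ (hm hx)).2
  have hfp : f p = 0 := by simp [f]
  have hfm : MapsTo f (ball p R) (closedBall (f p) 1) := by
    intro x hx
    rw [hfp, mem_closedBall_zero_iff]
    simp only [f, norm_div]
    exact div_le_one_of_le₀ (key _ (hm hx)).1 (norm_nonneg _)
  have h := Complex.dist_le_div_mul_dist_of_mapsTo_ball hf hfm hqB
  rw [hfp, dist_zero_right] at h
  have h' : ‖f q‖ ≤ 1/2 := by
    refine h.trans ?_
    rw [one_div_mul_eq_div, div_le_iff₀ hR]; linarith
  rw [rhoH_eq (hm hqB) hp]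
  by_contra hc
  rw [not_lt] at hc
  have ht := UpperHalfPlane.tanh_half_dist ⟨g q, hm hqB⟩ ⟨g p, hp⟩
  have ht2 : Real.tanh (dist (⟨g q, hm hqB⟩ : UpperHalfPlane) ⟨g p, hp⟩ / 2) = ‖f q‖ := by
    rw [ht]
    simp only [f, norm_div, dist_eq_norm]
  have := half_lt_tanh
    (show 1 ≤ dist (⟨g q, hm hqB⟩ : UpperHalfPlane) ⟨g p, hp⟩ / 2 by linarith)
  linarith

lemma ball_subset_of_infDist {Ω : Set ℂ} (ho : IsOpen Ω) {p : ℂ} (hp : p ∈ Ω) :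
    ball p (infDist p (frontier Ω)) ⊆ Ω := by
  by_cases h0 : 0 < infDist p (frontier Ω)
  · have hdis : Disjoint (ball p (infDist p (frontier Ω))) (frontier Ω) := disjoint_ball_infDist
    have hpre : IsPreconnected (ball p (infDist p (frontier Ω))) := (convex_ball p _).isPreconnected
    refine hpre.subset_of_closure_inter_subset ho ⟨p, mem_ball_self h0, hp⟩ ?_
    rintro x ⟨hx, hxb⟩
    by_contra hxΩ
    exact hdis.le_bot ⟨hxb, by rw [ho.frontier_eq]; exact ⟨hx, hxΩ⟩⟩
  · rw [ball_eq_empty.2 (not_lt.1 h0)]; exact empty_subset _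

/-- **Lemma `Johncone`.** Along an `L`-John curve with tip `z`, the
hyperbolic distance to the tip satisfies a logarithmic bound. -/
theorem john_curve_hyperbolic_bound (L : ℝ) (hL : 1 ≤ L) :
    ∃ β C : ℝ, 0 < β ∧ β ≤ 1 ∧ 0 < C ∧
      ∀ (Ω : Set ℂ) (φ : ℂ → ℂ) (α : ℝ → ℂ) (z : ℂ),
        IsOpen Ω → IsConnected Ω → Ω ≠ univ →
        DifferentiableOn ℂ φ UHP → InjOn φ UHP → φ '' UHP = Ω →
        z ∈ Ω → IsJohnCurve Ω L α z →
        ∀ t ∈ Ico (0:ℝ) 1,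
          rhoVia φ (α t) z ≤
            (1/β) * Real.log (infDist (α t) (frontier Ω) /
              infDist z (frontier Ω)) + C := by
  have hε : (0:ℝ) < 1 / (8 * (L + 1)) := by positivity
  obtain ⟨T, -, hTfin, hT⟩ := (isCompact_closedBall (0:ℂ) 1).finite_cover_balls hε
  lift T to Finset ℂ using hTfin
  set N : ℝ := (T.card : ℝ) with hN
  have hN0 : 0 ≤ N := Nat.cast_nonneg _
  have hlog2 : 0 < Real.log 2 := Real.log_pos (by norm_num)
  have hlogL : 0 ≤ Real.log (L + 1) := Real.log_nonneg (by linarith)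
  set A : ℝ := 2 * N / Real.log 2 + 1 with hA
  have hA1 : 1 ≤ A := by
    have : 0 ≤ 2 * N / Real.log 2 := by positivity
    linarith
  have hA0 : 0 < A := by linarith
  refine ⟨1 / A, A * Real.log (L + 1) + 4 * N + 1, by positivity,
    by rw [div_le_one hA0]; exact hA1, by positivity, ?_⟩
  intro Ω φ α z hΩo hΩc hΩne hφd hφi hφim hz ⟨hαc, hαi, hα0, hαm, hαJ⟩ t ht
  rw [one_div_one_div]
  -- the inverse map
  set g : ℂ → ℂ := invFunOn φ UHP with hg_def
  have hg : ∀ a ∈ UHP, g (φ a) = a := fun a ha => hφi.leftInvOn_invFunOn ha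
  have hgd : ∀ p ∈ Ω, DifferentiableAt ℂ g p := by
    rw [← hφim]
    rintro _ ⟨a, ha, rfl⟩
    exact inv_differentiableAt hφd hφi hg ha
  have hgm : ∀ p ∈ Ω, g p ∈ UHP := by
    rw [← hφim]
    rintro _ ⟨a, ha, rfl⟩
    rw [hg a ha]; exact ha
  -- the distance to the boundary
  have hFne : (frontier Ω).Nonempty := nonempty_frontier_iff.2 ⟨hΩc.nonempty, hΩne⟩
  have hδpos : ∀ p ∈ Ω, 0 < infDist p (frontier Ω) := by
    intro p hp
    rw [← isClosed_frontier.notMem_iff_infDist_pos hFne]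
    intro h
    exact (disjoint_frontier_iff_isOpen.2 hΩo).le_bot ⟨h, hp⟩
  have hloc : ∀ p ∈ Ω, ∀ q, dist q p ≤ infDist p (frontier Ω) / 2 → rhoH (g q) (g p) < 2 := by
    intro p hp q hq
    have hsub := ball_subset_of_infDist hΩo hp
    exact schwarz_UHP (fun x hx => (hgd x (hsub hx)).differentiableWithinAt)
      (fun x hx => hgm x (hsub hx)) (hδpos p hp) hq
  set d := infDist z (frontier Ω) with hd
  have hd0 : 0 < d := hδpos z hz
  set δt := infDist (α t) (frontier Ω) with hδt
  have htΩ : α t ∈ Ω := hαm ht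
  have hδt0 : 0 < δt := hδpos _ htΩ
  have hsI : ∀ s ∈ Icc 0 t, s ∈ Ico (0:ℝ) 1 := fun s hs => ⟨hs.1, hs.2.trans_lt ht.2⟩
  have hdiam : ∀ s ∈ Icc 0 t, ∀ u ∈ Icc 0 s, dist (α u) z ≤ diam (α '' Icc 0 s) := by
    intro s hs u hu
    rw [← hα0]
    refine dist_le_diam_of_mem ?_ (mem_image_of_mem _ hu)
      (mem_image_of_mem _ ⟨le_rfl, hs.1⟩)
    exact (isCompact_Icc.image_of_continuousOn
      (hαc.mono fun x hx => ⟨hx.1, hx.2.trans_lt (hsI s hs).2⟩)).isBounded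
  have h1 : ∀ s ∈ Icc 0 t, dist (α s) z ≤ L * infDist (α s) (frontier Ω) := fun s hs =>
    (hdiam s hs s ⟨hs.1, le_rfl⟩).trans (hαJ s (hsI s hs))
  have h2 : ∀ s ∈ Icc 0 t, d ≤ (L + 1) * infDist (α s) (frontier Ω) := by
    intro s hs
    have := infDist_le_infDist_add_dist (s := frontier Ω) (x := z) (y := α s)
    rw [dist_comm] at this
    have := h1 s hs
    linarith
  have htt : t ∈ Icc 0 t := ⟨ht.1, le_rfl⟩
  have h3 : ∀ s ∈ Icc 0 t, dist (α s) z ≤ (L + 1) * δt := by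
    intro s hs
    have := (hdiam t htt s hs).trans (hαJ t ht)
    linarith
  set Y : ℝ := (L + 1) * δt / d with hY
  have hY1 : 1 ≤ Y := by rw [hY, le_div_iff₀ hd0, one_mul]; exact h2 t htt
  set n₀ : ℕ := ⌈Real.logb 2 Y⌉₊ with hn₀
  have hn₀Y : Y ≤ 2 ^ n₀ := by
    have h := Nat.le_ceil (Real.logb 2 Y)
    rw [Real.logb_le_iff_le_rpow (by norm_num) (by linarith)] at h
    rwa [Real.rpow_natCast] at h
  have h4 : ∀ s ∈ Icc 0 t, dist (α s) z ≤ 2 ^ n₀ * d := by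
    intro s hs
    refine (h3 s hs).trans ?_
    rwa [hY, div_le_iff₀ hd0] at hn₀Y
  have h5 : ∀ s ∈ Icc 0 t, ∃ n ≤ n₀, dist (α s) z ≤ 2 ^ n * d ∧
      2 ^ n * d ≤ 2 * (L + 1) * infDist (α s) (frontier Ω) := by
    intro s hs
    have hex : ∃ n : ℕ, dist (α s) z ≤ 2 ^ n * d := ⟨n₀, h4 s hs⟩
    classical
    refine ⟨Nat.find hex, Nat.find_min' hex (h4 s hs), Nat.find_spec hex, ?_⟩
    have hpos : 0 ≤ infDist (α s) (frontier Ω) := infDist_nonneg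
    rcases hcase : Nat.find hex with _ | m
    · have := h2 s hs
      have := mul_nonneg (show 0 ≤ L + 1 by linarith) hpos
      simp only [pow_zero, one_mul]
      linarith
    · have hm := Nat.find_min hex (m := m) (by omega)
      rw [not_le] at hm
      have := h1 s hs
      rw [pow_succ]
      linarith
  have h6 : ∀ s ∈ Icc 0 t, ∃ nc : ℕ × ℂ, nc ∈ Finset.range (n₀ + 1) ×ˢ T ∧
      dist (α s) (z + (2 ^ nc.1 * d : ℝ) * nc.2) < 2 ^ nc.1 * d * (1 / (8 * (L + 1))) ∧
      2 ^ nc.1 * d ≤ 2 * (L + 1) * infDist (α s) (frontier Ω) := by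
    intro s hs
    obtain ⟨n, hn, hn1, hn2⟩ := h5 s hs
    set R : ℝ := 2 ^ n * d with hR
    have hR0 : 0 < R := by positivity
    have hRC : (R : ℂ) ≠ 0 := by exact_mod_cast hR0.ne'
    have hmem : (α s - z) / R ∈ closedBall (0:ℂ) 1 := by
      rw [mem_closedBall_zero_iff, norm_div, Complex.norm_real, Real.norm_of_nonneg hR0.le,
        div_le_one hR0, ← dist_eq_norm]
      exact hn1
    have := hT hmem
    simp only [mem_iUnion] at this
    obtain ⟨c, hc, hcb⟩ := this
    refine ⟨(n, c), Finset.mem_product.2 ⟨Finset.mem_range.2 (by omega), hc⟩, ?_, hn2⟩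
    change dist (α s) (z + (R : ℂ) * c) < R * (1 / (8 * (L + 1)))
    have he : α s - (z + (R : ℂ) * c) = R * ((α s - z) / R - c) := by field_simp; ring
    rw [dist_eq_norm, he, norm_mul, Complex.norm_real, Real.norm_of_nonneg hR0.le]
    rw [mem_ball, dist_eq_norm] at hcb
    exact mul_lt_mul_of_pos_left hcb hR0
  -- the hyperbolic distance along the curve
  set f : ℝ → ℝ := fun s => rhoH (g (α s)) (g z) with hf
  have hfc : ContinuousOn f (Icc 0 t) := by
    have hgc : ContinuousOn (fun s => g (α s)) (Icc 0 t) := by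
      intro s hs
      exact ContinuousAt.comp_continuousWithinAt (hgd _ (hαm (hsI s hs))).continuousAt
        ((hαc.mono hsI) s hs)
    have him : ContinuousOn (fun s => (g (α s)).im) (Icc 0 t) :=
      Complex.continuous_im.comp_continuousOn hgc
    have hdc : ContinuousOn (fun s => dist (g (α s)) (g z)) (Icc 0 t) :=
      (continuous_id.dist continuous_const).comp_continuousOn hgc
    simp only [hf, rhoH]
    refine continuousOn_const.mul (Real.continuous_arsinh.comp_continuousOn ?_)
    refine hdc.div
      (continuousOn_const.mul (him.mul continuousOn_const).sqrt) ?_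
    intro s hs
    have e1 : 0 < (g (α s)).im := hgm _ (hαm (hsI s hs))
    have e2 : 0 < (g z).im := hgm _ hz
    positivity
  have hf0 : f 0 = 0 := by simp [hf, rhoH, hα0]
  have htri : ∀ s ∈ Icc 0 t, ∀ u ∈ Icc 0 t, f s - f u ≤ rhoH (g (α s)) (g (α u)) ∧
      f s - f u ≤ rhoH (g (α u)) (g (α s)) := by
    intro s hs u hu
    have e1 := hgm _ (hαm (hsI s hs))
    have e2 := hgm _ (hαm (hsI u hu))
    have e3 := hgm _ hz
    simp only [hf]
    rw [rhoH_eq e1 e3, rhoH_eq e2 e3, rhoH_eq e1 e2, rhoH_eq e2 e1]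
    have := dist_triangle (⟨g (α s), e1⟩ : UpperHalfPlane) ⟨g (α u), e2⟩ ⟨g z, e3⟩
    have := dist_comm (⟨g (α s), e1⟩ : UpperHalfPlane) ⟨g (α u), e2⟩
    constructor <;> linarith
  have hft0 : 0 ≤ f t := by
    simp only [hf]
    rw [rhoH_eq (hgm _ htΩ) (hgm _ hz)]
    exact dist_nonneg
  set K : ℕ := ⌊f t / 2⌋₊ with hK
  have hKle : (K : ℝ) ≤ f t / 2 := Nat.floor_le (by linarith)
  have hKlt : f t / 2 < K + 1 := Nat.lt_floor_add_one _
  have hsk : ∀ k : ℕ, ∃ s ∈ Icc 0 t, k ≤ K → f s = 2 * k := by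
    intro k
    by_cases hk : k ≤ K
    · have hk' : (k : ℝ) ≤ K := by exact_mod_cast hk
      have : (2 * k : ℝ) ∈ Icc (f 0) (f t) := ⟨by rw [hf0]; positivity, by linarith⟩
      obtain ⟨s, hs, hse⟩ := intermediate_value_Icc ht.1 hfc this
      exact ⟨s, hs, fun _ => hse⟩
    · exact ⟨t, htt, fun h => absurd h hk⟩
  choose σ hσ hσf using hsk
  choose nc hnc1 hnc2 hnc3 using fun k => h6 (σ k) (hσ k)
  have hcard : K + 1 ≤ (n₀ + 1) * T.card := by
    by_contra hlt
    rw [not_le] at hlt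
    obtain ⟨j, hj, k, hk, hjk, he⟩ := Finset.exists_ne_map_eq_of_card_lt_of_maps_to
      (s := Finset.range (K + 1)) (t := Finset.range (n₀ + 1) ×ˢ T) (f := nc)
      (by simpa [Finset.card_product] using hlt) (fun k _ => hnc1 k)
    wlog hlt' : j < k generalizing j k
    · exact this k hk j hj hjk.symm he.symm (by omega)
    have hj2 := hnc2 j
    have hk2 := hnc2 k
    rw [he] at hj2
    have hk3 := hnc3 k
    have hdist : dist (α (σ j)) (α (σ k)) ≤ infDist (α (σ k)) (frontier Ω) / 2 := by
      refine (dist_triangle_right _ _ _).trans ((add_lt_add hj2 hk2).le.trans ?_)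
      have hL1 : 0 < L + 1 := by linarith
      calc _ = 2 ^ (nc k).1 * d / (4 * (L + 1)) := by field_simp; ring
        _ ≤ 2 * (L + 1) * infDist (α (σ k)) (frontier Ω) / (4 * (L + 1)) := by gcongr
        _ = _ := by field_simp; ring
    have hr := hloc _ (hαm (hsI _ (hσ k))) _ hdist
    have ht := (htri _ (hσ k) _ (hσ j)).2
    rw [hσf k (by simpa [Nat.lt_succ_iff] using hk), hσf j (by simpa [Nat.lt_succ_iff] using hj)] at ht
    have : (j : ℝ) + 1 ≤ k := by exact_mod_cast hlt'
    linarith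
  have hcardR : (K : ℝ) + 1 ≤ (n₀ + 1) * N := by
    rw [hN]; exact_mod_cast hcard
  have hlogY : 0 ≤ Real.log Y := Real.log_nonneg hY1
  have hn₀le : (n₀ : ℝ) ≤ Real.log Y / Real.log 2 + 1 :=
    (Nat.ceil_lt_add_one (by simp only [Real.logb]; positivity)).le
  have hYe : Real.log Y = Real.log (L + 1) + Real.log (δt / d) := by
    rw [hY, mul_div_assoc, Real.log_mul (by linarith) (by positivity)]
  change f t ≤ _
  have hfin : f t ≤ 2 * N / Real.log 2 * Real.log Y + 4 * N := by
    have e1 : ((n₀ : ℝ) + 1) * N ≤ (Real.log Y / Real.log 2 + 2) * N :=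
      mul_le_mul_of_nonneg_right (by linarith) hN0
    have e2 : 2 * ((Real.log Y / Real.log 2 + 2) * N) =
      2 * N / Real.log 2 * Real.log Y + 4 * N := by ring
    linarith
  have e3 : A * Real.log Y = 2 * N / Real.log 2 * Real.log Y + Real.log Y := by rw [hA]; ring
  have e4 : A * Real.log Y = A * Real.log (L + 1) + A * Real.log (δt / d) := by rw [hYe]; ring
  linarith
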